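/- arXiv:2404.08537 — 3 statements merged into one kernel-verified Lean document; each statement's English description precedes it below -/
import Mathlib

section
/- Let (X, d) be a metric space equipped with a Borel measure μ such that every ball of positive radius has positive and finite measure. Let p₁, p₂ ∈ X, let b = d(p₁, p₂), and let n be a positive integer. Assume the volume comparison property: for every r > b, μ(B(p₁, r+b)) ≤ ((r+b)/(r−b))^(2n) · μ(B(p₁, r−b)). Let f : X → [0, ∞) be a Borel measurable function and let a ∈ ℝ. If r² · ⨍_{B(p₁,r)} f dμ → a as r → ∞, then also r² · ⨍_{B(p₂,r)} f dμ → a as r → ∞. (Here ⨍_{B} f dμ denotes the average (1/μ(B)) ∫_B f dμ, and B(p,r) is the open metric ball.) -/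
open MeasureTheory Metric Filter

/-- If `s ⊆ t` and `μ t ≤ c * μ s`, then the average over `s` of a nonnegative function is at
most `c` times its average over `t`. -/
theorem setAverage_le_mul_setAverage_of_subset {X : Type*} [MeasurableSpace X] {μ : Measure X}
    {s t : Set X} {f : X → ℝ} {c : ℝ} (hst : s ⊆ t) (hf0 : ∀ x, 0 ≤ f x)
    (hft : IntegrableOn f t μ) (hs : 0 < μ.real s) (ht : 0 < μ.real t)
    (hc : μ.real t ≤ c * μ.real s) :
    ⨍ x in s, f x ∂μ ≤ c * ⨍ x in t, f x ∂μ := by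
  simp only [setAverage_eq, smul_eq_mul]
  have hint : ∫ x in s, f x ∂μ ≤ ∫ x in t, f x ∂μ :=
    setIntegral_mono_set hft (Eventually.of_forall hf0) (Eventually.of_forall hst)
  have ht0 : 0 ≤ ∫ x in t, f x ∂μ := integral_nonneg hf0
  have hinv : (μ.real s)⁻¹ ≤ c * (μ.real t)⁻¹ := by
    rw [← div_eq_mul_inv, le_div_iff₀ ht, inv_mul_le_iff₀ hs]
    linarith
  calc (μ.real s)⁻¹ * ∫ x in s, f x ∂μ
      ≤ (μ.real s)⁻¹ * ∫ x in t, f x ∂μ := by gcongr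
    _ ≤ c * (μ.real t)⁻¹ * ∫ x in t, f x ∂μ := by gcongr
    _ = c * ((μ.real t)⁻¹ * ∫ x in t, f x ∂μ) := by ring

theorem setAverage_eq_zero_of_not_integrableOn {X : Type*} [MeasurableSpace X] {μ : Measure X}
    {s : Set X} {f : X → ℝ} (hf : ¬ IntegrableOn f s μ) : ⨍ x in s, f x ∂μ = 0 := by
  rw [setAverage_eq, integral_undef hf, smul_zero]

theorem tendsto_add_const_div_add_const_atTop (x y : ℝ) :
    Tendsto (fun r : ℝ => (r + x) / (r + y)) atTop (nhds 1) := by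
  have h : Tendsto (fun r : ℝ => 1 + (x - y) / (r + y)) atTop (nhds (1 + 0)) :=
    tendsto_const_nhds.add
      (tendsto_const_nhds.div_atTop (tendsto_atTop_add_const_right atTop y tendsto_id))
  rw [add_zero] at h
  refine h.congr' ?_
  filter_upwards [eventually_gt_atTop (-y)] with r hr
  have : r + y ≠ 0 := by linarith
  field_simp
  ring

/-- Base-point independence of the limit `lim r² ⨍_{B(p,r)} f` under the
Bishop–Gromov type volume comparison (finite limit case). -/
theorem basepoint_independence_finite
    {X : Type*} [MetricSpace X] [MeasurableSpace X] [BorelSpace X]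
    (μ : Measure X)
    (hballs : ∀ (p : X) (r : ℝ), 0 < r → 0 < μ (ball p r) ∧ μ (ball p r) < ⊤)
    (p₁ p₂ : X) (b : ℝ) (hb : b = dist p₁ p₂) (n : ℕ) (hn : 0 < n)
    (hcomp : ∀ r : ℝ, b < r →
      μ (ball p₁ (r + b)) ≤ ENNReal.ofReal (((r + b) / (r - b)) ^ (2 * n)) * μ (ball p₁ (r - b)))
    (f : X → ℝ) (hf : Measurable f) (hf0 : ∀ x, 0 ≤ f x) (a : ℝ)
    (hlim : Tendsto (fun r : ℝ => r ^ 2 * ⨍ x in ball p₁ r, f x ∂μ) atTop (nhds a)) :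
    Tendsto (fun r : ℝ => r ^ 2 * ⨍ x in ball p₂ r, f x ∂μ) atTop (nhds a) := by
  have hb0 : 0 ≤ b := hb ▸ dist_nonneg
  have hsub₁ (r : ℝ) : ball p₁ (r - b) ⊆ ball p₂ r := ball_subset_ball' (by linarith)
  have hsub₂ (r : ℝ) : ball p₂ r ⊆ ball p₁ (r + b) :=
    ball_subset_ball' (by rw [dist_comm, hb])
  by_cases hint : ∀ r, IntegrableOn f (ball p₁ r) μ
  · have hpos (p : X) {r : ℝ} (hr : 0 < r) : 0 < μ.real (ball p r) :=
      ENNReal.toReal_pos (hballs p r hr).1.ne' (hballs p r hr).2.ne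
    have hmono {p q : X} {r s : ℝ} (hs : 0 < s) (h : ball p r ⊆ ball q s) :
        μ.real (ball p r) ≤ μ.real (ball q s) := measureReal_mono h (hballs q s hs).2.ne
    have hvol {r : ℝ} (hr : b < r) :
        μ.real (ball p₁ (r + b)) ≤ ((r + b) / (r - b)) ^ (2 * n) * μ.real (ball p₁ (r - b)) := by
      have h := ENNReal.toReal_mono
        (ENNReal.mul_ne_top ENNReal.ofReal_ne_top (hballs p₁ (r - b) (by linarith)).2.ne)
        (hcomp r hr)
      have h0 : 0 ≤ (r + b) / (r - b) := div_nonneg (by linarith) (by linarith)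
      rwa [ENNReal.toReal_mul, ENNReal.toReal_ofReal (by positivity)] at h
    have hratio : Tendsto (fun r : ℝ => ((r + b) / (r - b)) ^ (2 * n)) atTop (nhds 1) := by
      simpa [sub_eq_add_neg] using (tendsto_add_const_div_add_const_atTop b (-b)).pow (2 * n)
    have hscale (x : ℝ) : Tendsto (fun r : ℝ => (r / (r + x)) ^ 2 *
        ((r + x) ^ 2 * ⨍ y in ball p₁ (r + x), f y ∂μ)) atTop (nhds a) := by
      simpa using ((tendsto_add_const_div_add_const_atTop 0 x).pow 2).mul
        (hlim.comp (tendsto_atTop_add_const_right atTop x tendsto_id))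
    have hlower := (hscale (-b)).div hratio one_ne_zero
    have hupper := hratio.mul (hscale b)
    rw [div_one] at hlower
    rw [one_mul] at hupper
    have hcancel (r x A : ℝ) (h : r + x ≠ 0) :
        (r / (r + x)) ^ 2 * ((r + x) ^ 2 * A) = r ^ 2 * A := by field_simp
    refine tendsto_of_tendsto_of_tendsto_of_le_of_le' hlower hupper ?_ ?_ <;>
      filter_upwards [eventually_gt_atTop b] with r hr
    · have hc : 0 < ((r + b) / (r - b)) ^ (2 * n) :=
        pow_pos (div_pos (by linarith) (by linarith)) _
      have h := setAverage_le_mul_setAverage_of_subset (hsub₁ r) hf0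
        ((hint _).mono_set (hsub₂ r)) (hpos p₁ (by linarith)) (hpos p₂ (by linarith))
        ((hmono (by linarith) (hsub₂ r)).trans (hvol hr))
      simp only [Pi.div_apply]
      rw [hcancel r (-b) _ (by linarith), ← sub_eq_add_neg, div_le_iff₀ hc]
      nlinarith [mul_le_mul_of_nonneg_left h (sq_nonneg r)]
    · have hc : 0 < ((r + b) / (r - b)) ^ (2 * n) :=
        pow_pos (div_pos (by linarith) (by linarith)) _
      have h := setAverage_le_mul_setAverage_of_subset (hsub₂ r) hf0 (hint _)
        (hpos p₂ (by linarith)) (hpos p₁ (by linarith))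
        ((hvol hr).trans (mul_le_mul_of_nonneg_left (hmono (by linarith) (hsub₁ r)) hc.le))
      rw [hcancel r b _ (by linarith)]
      nlinarith [mul_le_mul_of_nonneg_left h (sq_nonneg r)]
  · -- Both averages eventually take the default value `0` of a non-integrable function.
    push Not at hint
    obtain ⟨R, hR⟩ := hint
    have ha : a = 0 := by
      refine tendsto_nhds_unique hlim (tendsto_const_nhds.congr' ?_)
      filter_upwards [eventually_ge_atTop R] with r hr
      rw [setAverage_eq_zero_of_not_integrableOn
        fun h => hR (h.mono_set (ball_subset_ball hr)), mul_zero]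
    rw [ha]
    refine tendsto_const_nhds.congr' ?_
    filter_upwards [eventually_ge_atTop (R + b)] with r hr
    rw [setAverage_eq_zero_of_not_integrableOn fun h => hR (h.mono_set
      ((ball_subset_ball (by linarith)).trans (hsub₁ r))), mul_zero]
end

section
/- Let (K, d) be a nonempty bounded metric space with its Borel σ-algebra, let ν be a nonzero finite Borel measure on K, let k₀ ∈ K, and let s be a positive integer. For r > 0 define A(r) = {(k, x) ∈ K × ℝ^s : d(k, k₀)² + ‖x‖² < r²} (the open ball of radius r around (k₀, 0) in the ℓ²-product metric), and let μ = ν ⊗ λ where λ is Lebesgue measure on ℝ^s. Then for every t > 0, the ratio μ(A(t·r)) / μ(A(r)) converges to t^s as r → ∞. -/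
open MeasureTheory Filter

/-- The open ball of radius `r` around `(k₀, 0)` for the `ℓ²`-product metric, in the product of a
bounded space and a finite-dimensional normed space `E`, has the growth of a ball of `E`. -/
theorem tendsto_prod_ball_div_pow {K E : Type*} [PseudoMetricSpace K] [MeasurableSpace K]
    (hK : Bornology.IsBounded (Set.univ : Set K)) (ν : Measure K) [SFinite ν] (k₀ : K)
    [NormedAddCommGroup E] [NormedSpace ℝ E] [FiniteDimensional ℝ E] [MeasurableSpace E]
    [BorelSpace E] (m : Measure E) [m.IsAddHaarMeasure] :
    Tendsto (fun r : ℝ => ν.prod m {q : K × E | dist q.1 k₀ ^ 2 + ‖q.2‖ ^ 2 < r ^ 2} /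
        ENNReal.ofReal (r ^ Module.finrank ℝ E)) atTop
      (nhds (ν Set.univ * m (Metric.ball 0 1))) := by
  obtain ⟨D, hD⟩ := hK.subset_closedBall k₀
  have hdist (k : K) : dist k k₀ ≤ D := hD (Set.mem_univ k)
  have hlim : Tendsto (fun r : ℝ => √(1 - (D / r) ^ 2) ^ Module.finrank ℝ E) atTop (nhds 1) := by
    have h : Tendsto (fun r : ℝ => D / r) atTop (nhds 0) := tendsto_const_nhds.div_atTop tendsto_id
    simpa using (((h.pow 2).const_sub 1).sqrt).pow (Module.finrank ℝ E)
  have hlower : Tendsto (fun r : ℝ => ENNReal.ofReal (√(1 - (D / r) ^ 2) ^ Module.finrank ℝ E) *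
      (ν Set.univ * m (Metric.ball 0 1))) atTop (nhds (ν Set.univ * m (Metric.ball 0 1))) := by
    simpa using ENNReal.Tendsto.mul_const (b := ν Set.univ * m (Metric.ball 0 1))
      (ENNReal.tendsto_ofReal hlim) (by simp)
  have hprod {ρ : ℝ} (hρ : 0 < ρ) : ν.prod m (Set.univ ×ˢ Metric.ball 0 ρ) =
      ENNReal.ofReal (ρ ^ Module.finrank ℝ E) * (ν Set.univ * m (Metric.ball 0 1)) := by
    rw [Measure.prod_prod, Measure.addHaar_ball_of_pos m 0 hρ]
    ring
  refine tendsto_of_tendsto_of_tendsto_of_le_of_le' hlower tendsto_const_nhds ?_ ?_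
  · filter_upwards [eventually_gt_atTop 0, eventually_gt_atTop |D|] with r hr hrD
    have hsq : 0 < 1 - (D / r) ^ 2 := by
      rw [sub_pos, sq_lt_one_iff_abs_lt_one, abs_div, abs_of_pos hr]
      exact (div_lt_one hr).2 hrD
    rw [ENNReal.le_div_iff_mul_le (by simp [hr]) (by simp), mul_right_comm,
      ← ENNReal.ofReal_mul (by positivity), ← mul_pow, ← hprod (by positivity)]
    refine measure_mono fun q hq => ?_
    have hq₂ : ‖q.2‖ < √(1 - (D / r) ^ 2) * r := by simpa using hq.2
    have hnorm : ‖q.2‖ ^ 2 < r ^ 2 - D ^ 2 := by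
      calc ‖q.2‖ ^ 2 < (√(1 - (D / r) ^ 2) * r) ^ 2 := by gcongr
        _ = r ^ 2 - D ^ 2 := by
          rw [mul_pow, Real.sq_sqrt hsq.le]
          field_simp
    have hD₂ : dist q.1 k₀ ^ 2 ≤ D ^ 2 := by
      gcongr
      exact hdist q.1
    simp only [Set.mem_ofPred_eq]
    linarith
  · filter_upwards [eventually_gt_atTop 0] with r hr
    refine ENNReal.div_le_of_le_mul' ?_
    rw [← hprod hr]
    refine measure_mono fun q hq => ⟨Set.mem_univ _, ?_⟩
    rw [mem_ball_zero_iff]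
    refine lt_of_pow_lt_pow_left₀ 2 hr.le ?_
    have := sq_nonneg (dist q.1 k₀)
    simp only [Set.mem_ofPred_eq] at hq
    linarith

/-- Functions with asymptotic growth `c * r ^ n` satisfy `f (t * r) / f r → t ^ n`. -/
theorem ENNReal.tendsto_ratio_of_tendsto_div_pow {f : ℝ → ENNReal} {n : ℕ} {c : ENNReal}
    (hf : Tendsto (fun r => f r / ENNReal.ofReal (r ^ n)) atTop (nhds c)) (hc₀ : c ≠ 0)
    (hc : c ≠ ⊤) {t : ℝ} (ht : 0 < t) :
    Tendsto (fun r => f (t * r) / f r) atTop (nhds (ENNReal.ofReal (t ^ n))) := by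
  have hft := hf.comp (tendsto_id.const_mul_atTop ht)
  have hratio := ENNReal.Tendsto.const_mul (a := ENNReal.ofReal (t ^ n))
    (ENNReal.Tendsto.div hft (.inl hc₀) hf (.inl hc)) (.inr ENNReal.ofReal_ne_top)
  rw [ENNReal.div_self hc₀ hc, mul_one] at hratio
  refine hratio.congr' ?_
  filter_upwards [eventually_gt_atTop 0] with r hr
  have ht₀ : ENNReal.ofReal (t ^ n) ≠ 0 := by simp [ht]
  have hr₀ : ENNReal.ofReal (r ^ n) ≠ 0 := by simp [hr]
  simp only [Function.comp_apply, id_eq]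
  rw [mul_pow, ENNReal.ofReal_mul (by positivity), ← mul_div_assoc, ← mul_div_assoc,
    ENNReal.mul_div_mul_left _ _ ht₀ ENNReal.ofReal_ne_top,
    div_eq_mul_inv _ (ENNReal.ofReal (r ^ n)), div_eq_mul_inv _ (ENNReal.ofReal (r ^ n)),
    ENNReal.mul_div_mul_right _ _ (ENNReal.inv_ne_zero.2 ENNReal.ofReal_ne_top)
      (ENNReal.inv_ne_top.2 hr₀)]

/-- Volume ratio asymptotics for balls in the product of a bounded metric measure
space with Euclidean space: `μ(A(t·r))/μ(A(r)) → t^s` as `r → ∞`. -/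
theorem product_ball_volume_ratio
    {K : Type*} [MetricSpace K] [MeasurableSpace K] [BorelSpace K]
    [Nonempty K] (hKbdd : Bornology.IsBounded (Set.univ : Set K))
    (ν : Measure K) [IsFiniteMeasure ν] (hν : ν ≠ 0)
    (k₀ : K) (s : ℕ) (hs : 0 < s)
    (A : ℝ → Set (K × EuclideanSpace ℝ (Fin s)))
    (hA : ∀ r : ℝ, A r = {q : K × EuclideanSpace ℝ (Fin s) |
      dist q.1 k₀ ^ 2 + ‖q.2‖ ^ 2 < r ^ 2})
    (μ : Measure (K × EuclideanSpace ℝ (Fin s))) (hμ : μ = ν.prod volume) :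
    ∀ t : ℝ, 0 < t →
      Tendsto (fun r : ℝ => μ (A (t * r)) / μ (A r)) atTop (nhds (ENNReal.ofReal (t ^ s))) := by
  intro t ht
  have hlim := tendsto_prod_ball_div_pow hKbdd ν k₀ (volume : Measure (EuclideanSpace ℝ (Fin s)))
  rw [finrank_euclideanSpace_fin] at hlim
  simp only [hμ, hA]
  exact ENNReal.tendsto_ratio_of_tendsto_div_pow hlim
    (mul_ne_zero (by simpa using hν) (Metric.measure_ball_pos _ _ one_pos).ne')
    (ENNReal.mul_ne_top (measure_ne_top _ _) measure_ball_lt_top.ne) ht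
end

section
/- Let n be a positive integer and let d, d' : {1, …, n} → ℝ be nondecreasing functions with dⱼ ≥ 1 and d'ⱼ ≥ 1 for every j. Suppose that for every real t, the number of tuples (a₁, …, aₙ) of nonnegative integers with Σ_{j=1}^n dⱼ aⱼ ≤ t equals the number of tuples (a₁, …, aₙ) of nonnegative integers with Σ_{j=1}^n d'ⱼ aⱼ ≤ t. Then dⱼ = d'ⱼ for every j. -/
open Finset

/-- A weighted lattice simplex with weights at least one has finitely many points. -/
theorem finite_setOf_weighted_sum_le {ι : Type*} [Fintype ι] {d : ι → ℝ} (hd : ∀ j, 1 ≤ d j)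
    (t : ℝ) : {a : ι → ℕ | ∑ j, d j * (a j : ℝ) ≤ t}.Finite := by
  classical
  refine (Set.finite_Iic (fun _ : ι => ⌊t⌋₊)).subset fun a ha j => Nat.le_floor ?_
  have hnonneg : ∀ i ∈ univ, 0 ≤ d i * (a i : ℝ) := fun i _ =>
    mul_nonneg (zero_le_one.trans (hd i)) (Nat.cast_nonneg _)
  calc (a j : ℝ) ≤ d j * a j := le_mul_of_one_le_left (Nat.cast_nonneg _) (hd j)
    _ ≤ ∑ i, d i * (a i : ℝ) := single_le_sum hnonneg (mem_univ j)
    _ ≤ t := ha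

/-- If two weight vectors agree below `k` and `d k < d' k`, then the simplex of size `d k` has
strictly more lattice points for `d` than for `d'`. -/
theorem card_weighted_sum_le_lt_of_lt {ι : Type*} [Fintype ι] [LinearOrder ι] {d d' : ι → ℝ}
    (hmono' : Monotone d') (hd : ∀ j, 1 ≤ d j) (hd' : ∀ j, 1 ≤ d' j) {k : ι}
    (heq : ∀ j < k, d j = d' j) (hlt : d k < d' k) :
    Nat.card {a : ι → ℕ | ∑ j, d' j * (a j : ℝ) ≤ d k} <
      Nat.card {a : ι → ℕ | ∑ j, d j * (a j : ℝ) ≤ d k} := by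
  have hzero : ∀ a : ι → ℕ, ∑ j, d' j * (a j : ℝ) ≤ d k → ∀ j, k ≤ j → a j = 0 := by
    intro a ha j hj
    by_contra hne
    have hone : (1 : ℝ) ≤ a j := by exact_mod_cast Nat.one_le_iff_ne_zero.2 hne
    have hnonneg : ∀ i ∈ univ, 0 ≤ d' i * (a i : ℝ) := fun i _ =>
      mul_nonneg (zero_le_one.trans (hd' i)) (Nat.cast_nonneg _)
    have hle : d' j * (a j : ℝ) ≤ d k := (single_le_sum hnonneg (mem_univ j)).trans ha
    have hself : d' j ≤ d' j * (a j : ℝ) :=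
      le_mul_of_one_le_right (zero_le_one.trans (hd' j)) hone
    linarith [hmono' hj]
  refine Set.ncard_lt_ncard ((Set.ssubset_iff_of_subset ?_).2 ⟨Pi.single k 1, ?_, ?_⟩)
    (finite_setOf_weighted_sum_le hd _)
  · intro a ha
    rw [Set.mem_ofPred_eq] at ha ⊢
    refine (sum_congr rfl fun j _ => ?_).trans_le ha
    rcases lt_or_ge j k with hj | hj
    · rw [heq j hj]
    · simp [hzero a ha j hj]
  · simp [Pi.single_apply]
  · intro hmem
    simpa using hzero _ hmem k le_rfl

/-- The counting function of a weighted lattice simplex determines the sorted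
weights: if two nondecreasing weight vectors `d, d' ≥ 1` yield the same number
of nonnegative integer solutions of `Σ dⱼ aⱼ ≤ t` for every `t`, they coincide. -/
theorem weights_determined_by_counting_function
    (n : ℕ) (hn : 0 < n) (d d' : Fin n → ℝ)
    (hmono : Monotone d) (hmono' : Monotone d')
    (hd : ∀ j, 1 ≤ d j) (hd' : ∀ j, 1 ≤ d' j)
    (hcount : ∀ t : ℝ,
      Nat.card {a : Fin n → ℕ | ∑ j, d j * (a j : ℝ) ≤ t} =
      Nat.card {a : Fin n → ℕ | ∑ j, d' j * (a j : ℝ) ≤ t}) :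
    ∀ j, d j = d' j := by
  intro j
  induction j using WellFoundedLT.induction with
  | ind k ih =>
    rcases lt_trichotomy (d k) (d' k) with h | h | h
    · exact absurd (hcount (d k)) (card_weighted_sum_le_lt_of_lt hmono' hd hd' ih h).ne'
    · exact h
    · exact absurd (hcount (d' k))
        (card_weighted_sum_le_lt_of_lt hmono hd' hd (fun j hj => (ih j hj).symm) h).ne
end
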